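/- Let 𝒬_L be the set of nonempty subsets Ω of Δ̃ whose stabilizer {z ∈ 𝒜_L | z(Ω) = Ω} acts transitively on Ω. For Ω ∈ 𝒬_L the coefficient n_α is constant on Ω (since n_{z(α)} = n_α for z ∈ 𝒜); denote its common value by n_Ω and set λ_Ω = (1/(n_Ω·|Ω|))·Σ_{α∈Ω} ϖ_α∨. Then the map Ω ↦ λ_Ω induces a bijection between the set of orbits of 𝒜_L on 𝒬_L and the set of orbits, under the group of affine transformations of V of the form v ↦ w(v) + l (w ∈ W, l ∈ L), of the set of elements of V that are quasi-isolated with respect to L. -/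

import Mathlib

open Module

/-- A reduced, irreducible, crystallographic root system `Φ` inside the dual of a
`ℚ`-vector space `V`: each root `α` has a coroot `α∨ ∈ V` with `⟨α, α∨⟩ = 2`, pairings
between roots and coroots are integers, the dual reflections permute the roots, the
system is reduced, the roots span `V*`, and the system is irreducible. -/
structure RootSystemData (V : Type*) [AddCommGroup V] [Module ℚ V] where
  Φ : Set (Module.Dual ℚ V)
  coroot : Module.Dual ℚ V → V
  finite : Φ.Finite
  span_eq_top : Submodule.span ℚ Φ = ⊤
  pairing_self : ∀ α ∈ Φ, α (coroot α) = 2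
  pairing_int : ∀ α ∈ Φ, ∀ β ∈ Φ, ∃ n : ℤ, (n : ℚ) = β (coroot α)
  reduced : ∀ α ∈ Φ, ∀ c : ℚ, c • α ∈ Φ → c = 1 ∨ c = -1
  dual_refl_mem : ∀ α ∈ Φ, ∀ β ∈ Φ, β - β (coroot α) • α ∈ Φ
  irreducible : ∀ s : Set (Module.Dual ℚ V), s ⊆ Φ → s.Nonempty →
      (∀ α ∈ s, ∀ β ∈ Φ, β ∉ s → β (coroot α) = 0) → s = Φ

variable {V : Type*} [AddCommGroup V] [Module ℚ V]

/-- The reflections `s_α : v ↦ v - ⟨α, v⟩ α∨` attached to the elements `α` of `S`. -/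
def reflSet (R : RootSystemData V) (S : Set (Module.Dual ℚ V)) : Set (V ≃ₗ[ℚ] V) :=
  {w | ∃ α ∈ S, ∀ v, w v = v - α v • R.coroot α}

/-- The subgroup of `GL(V)` generated by the reflections `s_α`, `α ∈ S`. -/
def weylOf (R : RootSystemData V) (S : Set (Module.Dual ℚ V)) : Subgroup (V ≃ₗ[ℚ] V) :=
  Subgroup.closure (reflSet R S)

/-- The Weyl group `W` of the root system. -/
def weyl (R : RootSystemData V) : Subgroup (V ≃ₗ[ℚ] V) :=
  weylOf R R.Φ

/-- The contragredient action of `w ∈ GL(V)` on the dual space: `β ↦ β ∘ w⁻¹`. -/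
def dact (w : V ≃ₗ[ℚ] V) (β : Module.Dual ℚ V) : Module.Dual ℚ V :=
  β.comp (w.symm.toLinearMap)

/-- The coroot lattice `Q∨`. -/
def corootLattice (R : RootSystemData V) : AddSubgroup V :=
  AddSubgroup.closure (R.coroot '' R.Φ)

/-- The coweight lattice `P∨ = {v ∈ V | ⟨α, v⟩ ∈ ℤ for all α ∈ Φ}`, as a set. -/
def coweightSet (R : RootSystemData V) : Set V :=
  {v | ∀ α ∈ R.Φ, ∃ n : ℤ, (n : ℚ) = α v}

/-- `m_α`: equal to `-1` on `α₀ = -α̃` and `0` elsewhere (in particular on `Δ`). -/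
noncomputable def mfun (αt α : Module.Dual ℚ V) : ℚ := by
  classical exact if α = -αt then -1 else 0

/-- The extended (affine) base `Δ̃ = Δ ∪ {-α̃}`. -/
def extBase (Δ : Finset (Module.Dual ℚ V)) (αt : Module.Dual ℚ V) :
    Set (Module.Dual ℚ V) :=
  insert (-αt) (Δ : Set (Module.Dual ℚ V))

/-- The closed fundamental alcove `C = {λ ∈ V | ⟨α, λ⟩ ≥ m_α for all α ∈ Δ̃}`. -/
def alcove (Δ : Finset (Module.Dual ℚ V)) (αt : Module.Dual ℚ V) : Set V :=
  {x | ∀ α ∈ extBase Δ αt, mfun αt α ≤ α x}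

/-- `Φ(λ) = {α ∈ Φ | ⟨α, λ⟩ ∈ ℤ}`. -/
def PhiOf (R : RootSystemData V) (x : V) : Set (Module.Dual ℚ V) :=
  {α | α ∈ R.Φ ∧ ∃ k : ℤ, (k : ℚ) = α x}

/-- `I_λ = {α ∈ Δ̃ | ⟨α, λ⟩ = m_α}` for `λ ∈ C`. -/
def IOf (Δ : Finset (Module.Dual ℚ V)) (αt : Module.Dual ℚ V) (x : V) :
    Set (Module.Dual ℚ V) :=
  {α | α ∈ extBase Δ αt ∧ α x = mfun αt α}

/-- `W°(λ)`: the subgroup of `W` generated by the reflections `s_α`, `α ∈ Φ(λ)`. -/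
def Wcirc (R : RootSystemData V) (x : V) : Subgroup (V ≃ₗ[ℚ] V) :=
  weylOf R (PhiOf R x)

/-- `𝒜 = {z ∈ W | z(Δ̃) = Δ̃}`: automorphisms of the affine Dynkin diagram induced by `W`. -/
def AutTilde (R : RootSystemData V) (Δ : Finset (Module.Dual ℚ V))
    (αt : Module.Dual ℚ V) : Set (V ≃ₗ[ℚ] V) :=
  {z | z ∈ weyl R ∧ dact z '' extBase Δ αt = extBase Δ αt}

/-- `𝒜_L = {z ∈ 𝒜 | ϖ∨(z) ∈ L}`, where `ϖ∨(z)` is the unique `v` with `z(C) + v = C`. -/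
def AutTildeL (R : RootSystemData V) (Δ : Finset (Module.Dual ℚ V))
    (αt : Module.Dual ℚ V) (L : AddSubgroup V) : Set (V ≃ₗ[ℚ] V) :=
  {z | z ∈ AutTilde R Δ αt ∧
    ∃ v ∈ L, (fun x => z x + v) '' alcove Δ αt = alcove Δ αt}

/-- The submodule of vectors of `V` fixed by every element of `S`. -/
def fixedSub (S : Set (V ≃ₗ[ℚ] V)) : Submodule ℚ V where
  carrier := {v | ∀ w ∈ S, w v = v}
  add_mem' := by
    intro a b ha hb w hw
    rw [map_add, ha w hw, hb w hw]
  zero_mem' := by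
    intro w hw
    exact map_zero w
  smul_mem' := by
    intro c v hv w hw
    rw [map_smul, hv w hw]

/-- The set of orbits of a subgroup `A ≤ GL(V)` acting (contragrediently) on a set `S`
of linear forms. -/
def orbitsOn (A : Subgroup (V ≃ₗ[ℚ] V)) (S : Set (Module.Dual ℚ V)) :
    Set (Set (Module.Dual ℚ V)) :=
  {O | ∃ α ∈ S, O = {β | ∃ z ∈ A, dact z α = β}}

/-- `λ_Ω = (1/(n_Ω·|Ω|))·Σ_{α∈Ω} ϖ_α∨` (written with `n_α` in place of the constant value
`n_Ω` of `n` on `Ω`). -/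
noncomputable def lamOf (n : Module.Dual ℚ V → ℕ) (ϖ : Module.Dual ℚ V → V)
    (Ω : Set (Module.Dual ℚ V)) : V :=
  ∑ᶠ α ∈ Ω, ((n α : ℚ) * (Ω.ncard : ℚ))⁻¹ • ϖ α

/-- `λ` is quasi-isolated with respect to `L` if the only vector fixed by every element of
`W_L(λ) = {w ∈ W | w(λ) - λ ∈ L}` is `0`. -/
def IsQuasiIsolated (R : RootSystemData V) (L : AddSubgroup V) (x : V) : Prop :=
  fixedSub {w : V ≃ₗ[ℚ] V | w ∈ weyl R ∧ w x - x ∈ L} = ⊥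

/-- `𝒬_L`: the set of nonempty subsets `Ω ⊆ Δ̃` whose stabilizer in `𝒜_L` acts
transitively on `Ω`. -/
def QSetOf (R : RootSystemData V) (Δ : Finset (Module.Dual ℚ V))
    (αt : Module.Dual ℚ V) (L : AddSubgroup V) : Set (Set (Module.Dual ℚ V)) :=
  {Ω | Ω ⊆ extBase Δ αt ∧ Ω.Nonempty ∧
    ∀ α ∈ Ω, ∀ β ∈ Ω, ∃ z ∈ AutTildeL R Δ αt L, dact z '' Ω = Ω ∧ dact z α = β}

/-! ### The Weyl group -/

theorem dact_apply (w : V ≃ₗ[ℚ] V) (β : Module.Dual ℚ V) (x : V) :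
    dact w β x = β (w.symm x) := rfl

theorem dact_apply_apply (w : V ≃ₗ[ℚ] V) (β : Module.Dual ℚ V) (x : V) :
    dact w β (w x) = β x := by
  simp [dact_apply]

theorem dact_injective (w : V ≃ₗ[ℚ] V) : Function.Injective (dact w) := by
  intro β γ h
  ext x
  rw [← dact_apply_apply w β x, h, dact_apply_apply]

namespace RootSystemData

variable (R : RootSystemData V)

theorem neg_mem {α : Module.Dual ℚ V} (hα : α ∈ R.Φ) : -α ∈ R.Φ := by
  have h := R.dual_refl_mem α hα α hα
  rw [R.pairing_self α hα] at h
  convert h using 1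
  module

theorem ne_zero {α : Module.Dual ℚ V} (hα : α ∈ R.Φ) : α ≠ 0 := by
  rintro rfl
  simpa using R.pairing_self 0 hα

/-- The reflection `s_α` of `V`. -/
noncomputable def refl {α : Module.Dual ℚ V} (hα : α ∈ R.Φ) : V ≃ₗ[ℚ] V :=
  Module.reflection (R.pairing_self α hα)

theorem refl_apply {α : Module.Dual ℚ V} (hα : α ∈ R.Φ) (v : V) :
    R.refl hα v = v - α v • R.coroot α :=
  Module.reflection_apply v (R.pairing_self α hα)

theorem refl_mem_weylOf {S : Set (Module.Dual ℚ V)} {α : Module.Dual ℚ V} (hα : α ∈ R.Φ)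
    (hS : α ∈ S) : R.refl hα ∈ weylOf R S :=
  Subgroup.subset_closure ⟨α, hS, R.refl_apply hα⟩

theorem weylOf_le {S : Set (Module.Dual ℚ V)} (hS : S ⊆ R.Φ) : weylOf R S ≤ weyl R :=
  Subgroup.closure_mono fun _ ⟨α, hα, h⟩ => ⟨α, hS hα, h⟩

theorem inv_apply_of_mem_reflSet {α : Module.Dual ℚ V} (hα : α ∈ R.Φ) {w : V ≃ₗ[ℚ] V}
    (hw : ∀ v, w v = v - α v • R.coroot α) (v : V) :
    w⁻¹ v = v - α v • R.coroot α := by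
  have : w (v - α v • R.coroot α) = v := by
    rw [hw, map_sub, map_smul, R.pairing_self α hα, smul_eq_mul]
    module
  exact (LinearEquiv.symm_apply_eq w).2 this.symm

theorem comp_mem {w : V ≃ₗ[ℚ] V} (hw : w ∈ weyl R) :
    ∀ β ∈ R.Φ, β.comp w.toLinearMap ∈ R.Φ ∧ dact w β ∈ R.Φ := by
  refine Subgroup.closure_induction (p := fun w _ =>
    ∀ β ∈ R.Φ, β.comp w.toLinearMap ∈ R.Φ ∧ dact w β ∈ R.Φ) ?_ ?_ ?_ ?_ hw
  · rintro w ⟨α, hα, h⟩ β hβ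
    have key := R.dual_refl_mem α hα β hβ
    constructor
    · convert key using 1
      ext v
      simp [h, mul_comm]
    · convert key using 1
      ext v
      have := R.inv_apply_of_mem_reflSet hα h v
      rw [dact_apply]
      change β (w⁻¹ v) = _
      simp [this, mul_comm]
  · intro β hβ
    exact ⟨hβ, hβ⟩
  · intro w₁ w₂ _ _ h₁ h₂ β hβ
    exact ⟨(h₂ _ (h₁ β hβ).1).1, (h₁ _ (h₂ β hβ).2).2⟩
  · intro w _ h β hβ
    exact ⟨(h β hβ).2, (h β hβ).1⟩

theorem corootLattice_subset_coweightSet {v : V} (hv : v ∈ corootLattice R) :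
    v ∈ coweightSet R := by
  intro α hα
  refine AddSubgroup.closure_induction (p := fun v _ => ∃ n : ℤ, (n : ℚ) = α v) ?_ ?_ ?_ ?_ hv
  · rintro _ ⟨β, hβ, rfl⟩
    exact R.pairing_int β hβ α hα
  · exact ⟨0, by simp⟩
  · rintro x y _ _ ⟨a, ha⟩ ⟨b, hb⟩
    exact ⟨a + b, by simp [ha, hb]⟩
  · rintro x _ ⟨a, ha⟩
    exact ⟨-a, by simp [ha]⟩

theorem coroot_mem {α : Module.Dual ℚ V} (hα : α ∈ R.Φ) : R.coroot α ∈ corootLattice R :=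
  AddSubgroup.subset_closure ⟨α, hα, rfl⟩

theorem sub_mem_corootLattice {S : Set (Module.Dual ℚ V)} (hS : S ⊆ R.Φ) {w : V ≃ₗ[ℚ] V}
    (hw : w ∈ weylOf R S) :
    ∀ v : V, (∀ α ∈ S, ∃ n : ℤ, (n : ℚ) = α v) →
      w v - v ∈ corootLattice R ∧ w⁻¹ v - v ∈ corootLattice R := by
  have hQ : ∀ v ∈ corootLattice R, ∀ α ∈ S, ∃ n : ℤ, (n : ℚ) = α v := fun v hv α hα =>
    R.corootLattice_subset_coweightSet hv α (hS hα)
  refine Subgroup.closure_induction (p := fun w _ =>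
    ∀ v : V, (∀ α ∈ S, ∃ n : ℤ, (n : ℚ) = α v) →
      w v - v ∈ corootLattice R ∧ w⁻¹ v - v ∈ corootLattice R) ?_ ?_ ?_ ?_ hw
  · rintro w ⟨α, hα, h⟩ v hv
    have hmem : (v - α v • R.coroot α) - v ∈ corootLattice R := by
      obtain ⟨k, hk⟩ := hv α hα
      have := (corootLattice R).zsmul_mem (R.coroot_mem (hS hα)) (-k)
      convert this using 1
      rw [← hk, ← Int.cast_smul_eq_zsmul ℚ]
      push_cast
      module
    rw [h v, R.inv_apply_of_mem_reflSet (hS hα) h v]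
    exact ⟨hmem, hmem⟩
  · intro v _
    simp
  · intro w₁ w₂ _ _ h₁ h₂ v hv
    have e₁ := (h₁ v hv)
    have e₂ := (h₂ v hv)
    have f₁ := (h₁ _ (hQ _ e₂.1)).1
    have f₂ := (h₂ _ (hQ _ e₁.2)).2
    constructor
    · have := add_mem (add_mem f₁ e₂.1) e₁.1
      convert this using 1
      simp only [LinearEquiv.mul_apply, map_sub]
      abel
    · have := add_mem (add_mem f₂ e₁.2) e₂.2
      convert this using 1
      simp only [mul_inv_rev, LinearEquiv.mul_apply, map_sub]
      abel
  · intro w _ h v hv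
    rw [inv_inv]
    exact (h v hv).symm

theorem apply_mem_of_weyl {L : AddSubgroup V} (hQL : (corootLattice R : Set V) ⊆ L)
    (hLP : (L : Set V) ⊆ coweightSet R) {w : V ≃ₗ[ℚ] V} (hw : w ∈ weyl R) {l : V}
    (hl : l ∈ L) : w l ∈ L := by
  have := hQL (R.sub_mem_corootLattice subset_rfl hw l (hLP hl)).1
  simpa using add_mem this hl

/-! ### An invariant quadratic form and closest points -/

/-- The Weyl-invariant positive definite quadratic form `u ↦ ∑_{β ∈ Φ} ⟨β, u⟩²`. -/
noncomputable def normSq (u : V) : ℚ := ∑ β ∈ R.finite.toFinset, β u ^ 2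

theorem normSq_coroot_pos {α : Module.Dual ℚ V} (hα : α ∈ R.Φ) :
    0 < R.normSq (R.coroot α) := by
  refine Finset.sum_pos' (fun β _ => sq_nonneg _) ⟨α, by simpa using hα, ?_⟩
  rw [R.pairing_self α hα]
  norm_num

theorem two_mul_sum_mul_coroot {α : Module.Dual ℚ V} (hα : α ∈ R.Φ) (u : V) :
    2 * ∑ β ∈ R.finite.toFinset, β u * β (R.coroot α) = α u * R.normSq (R.coroot α) := by
  set σ : Module.Dual ℚ V → Module.Dual ℚ V := fun β => β - β (R.coroot α) • α with hσ
  have hσσ : ∀ β, σ (σ β) = β := by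
    intro β
    simp only [hσ, LinearMap.sub_apply, LinearMap.smul_apply, R.pairing_self α hα, smul_eq_mul]
    module
  have hmem : ∀ β ∈ R.finite.toFinset, σ β ∈ R.finite.toFinset := by
    intro β hβ
    simp only [Set.Finite.mem_toFinset] at hβ ⊢
    exact R.dual_refl_mem α hα β hβ
  have h : ∑ β ∈ R.finite.toFinset, β u * β (R.coroot α)
      = ∑ β ∈ R.finite.toFinset, σ β u * σ β (R.coroot α) :=
    (Finset.sum_nbij' σ σ hmem hmem (fun β _ => hσσ β) (fun β _ => hσσ β)
      (fun β _ => rfl)).symm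
  have h' : ∀ β : Module.Dual ℚ V, σ β u * σ β (R.coroot α)
      = α u * β (R.coroot α) ^ 2 - β u * β (R.coroot α) := by
    intro β
    simp only [hσ, LinearMap.sub_apply, LinearMap.smul_apply, R.pairing_self α hα, smul_eq_mul]
    ring
  simp only [h', Finset.sum_sub_distrib, ← Finset.mul_sum] at h
  rw [normSq]
  linarith

theorem normSq_sub_smul_coroot {α : Module.Dual ℚ V} (hα : α ∈ R.Φ) (u : V) (c : ℚ) :
    R.normSq (u - c • R.coroot α)
      = R.normSq u + R.normSq (R.coroot α) * (c * (c - α u)) := by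
  have h : R.normSq (u - c • R.coroot α) = R.normSq u
      - c * (2 * ∑ β ∈ R.finite.toFinset, β u * β (R.coroot α))
      + c ^ 2 * R.normSq (R.coroot α) := by
    simp only [normSq, Finset.mul_sum, ← Finset.sum_sub_distrib, ← Finset.sum_add_distrib]
    refine Finset.sum_congr rfl fun β _ => ?_
    simp only [map_sub, map_smul, smul_eq_mul]
    ring
  rw [h, R.two_mul_sum_mul_coroot hα]
  ring

theorem exists_closest {S : Set V} (hS : S.Nonempty) (x₀ p : V)
    (h : ∀ x ∈ S, ∀ α ∈ R.Φ, ∃ β ∈ R.Φ, ∃ k : ℤ, α x = β x₀ + k) :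
    ∃ x ∈ S, ∀ x' ∈ S, R.normSq (x - p) ≤ R.normSq (x' - p) := by
  classical
  set D : ℕ := (∏ β ∈ R.finite.toFinset, (β x₀).den) * ∏ β ∈ R.finite.toFinset, (β p).den
    with hD
  have hDpos : 0 < D :=
    Nat.mul_pos (Finset.prod_pos fun β _ => Rat.den_pos _) (Finset.prod_pos fun β _ => Rat.den_pos _)
  have den_dvd : ∀ q : ℚ, q.den ∣ D → ∃ k : ℤ, (D : ℚ) * q = k := by
    rintro q ⟨e, he⟩
    refine ⟨e * q.num, ?_⟩
    rw [he]
    push_cast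
    rw [mul_comm (q.den : ℚ), mul_assoc, Rat.den_mul_eq_num]
  have hval : ∀ x ∈ S, ∀ α ∈ R.Φ, ∃ k : ℤ, (D : ℚ) * α (x - p) = k := by
    intro x hx α hα
    obtain ⟨β, hβ, k, hk⟩ := h x hx α hα
    obtain ⟨a, ha⟩ := den_dvd (β x₀) (Dvd.dvd.mul_right
      (Finset.dvd_prod_of_mem (fun β : Module.Dual ℚ V => (β x₀).den)
        (R.finite.mem_toFinset.2 hβ)) _)
    obtain ⟨b, hb⟩ := den_dvd (α p) (Dvd.dvd.mul_left
      (Finset.dvd_prod_of_mem (fun β : Module.Dual ℚ V => (β p).den)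
        (R.finite.mem_toFinset.2 hα)) _)
    refine ⟨a + D * k - b, ?_⟩
    push_cast
    rw [← ha, ← hb, map_sub, hk]
    ring
  have hnat : ∀ x ∈ S, ∃ N : ℕ, (D : ℚ) ^ 2 * R.normSq (x - p) = N := by
    intro x hx
    choose! k hk using hval x hx
    refine ⟨∑ β ∈ R.finite.toFinset, (k β).natAbs ^ 2, ?_⟩
    rw [normSq, Finset.mul_sum, Nat.cast_sum]
    refine Finset.sum_congr rfl fun β hβ => ?_
    rw [← mul_pow, hk β (R.finite.mem_toFinset.1 hβ)]
    simp [Nat.cast_natAbs]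
  choose! N hN using hnat
  obtain ⟨x, hx, hmin⟩ := exists_minimalFor_of_wellFoundedLT (· ∈ S) N hS
  refine ⟨x, hx, fun x' hx' => ?_⟩
  have hle : N x ≤ N x' := by
    by_contra hlt
    exact hlt (hmin hx' (le_of_not_ge hlt))
  have : (D : ℚ) ^ 2 * R.normSq (x - p) ≤ (D : ℚ) ^ 2 * R.normSq (x' - p) := by
    rw [hN x hx, hN x' hx']
    exact_mod_cast hle
  exact le_of_mul_le_mul_left this (by positivity)

end RootSystemData

/-! ### The fundamental alcove and its barycentric coordinates -/

/-- The extended base `Δ̃` as a finite set. -/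
noncomputable def extFin (Δ : Finset (Module.Dual ℚ V)) (αt : Module.Dual ℚ V) :
    Finset (Module.Dual ℚ V) := by
  classical exact insert (-αt) Δ

/-- The affine function `⟨α, ·⟩ - m_α`. -/
noncomputable def wallHeight (αt α : Module.Dual ℚ V) (x : V) : ℚ := α x - mfun αt α

/-- A base `Δ` of a root system together with its highest root `αt`, the coefficients `n` of
`αt` on `Δ` and the dual basis `ϖ` of `Δ`, the latter two extended to `-αt`. -/
structure IsExtendedBase (R : RootSystemData V) (Δ : Finset (Module.Dual ℚ V))
    (αt : Module.Dual ℚ V) (n : Module.Dual ℚ V → ℕ) (ϖ : Module.Dual ℚ V → V) : Prop where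
  subset : (Δ : Set (Module.Dual ℚ V)) ⊆ R.Φ
  nonneg_or_nonpos : ∀ β ∈ R.Φ, ∃ c : Module.Dual ℚ V → ℚ, (∀ α ∈ Δ, 0 ≤ c α) ∧
    (β = ∑ α ∈ Δ, c α • α ∨ -β = ∑ α ∈ Δ, c α • α)
  highest_mem : αt ∈ R.Φ
  highest : ∀ γ ∈ R.Φ, ∃ c : Module.Dual ℚ V → ℚ, (∀ α ∈ Δ, 0 ≤ c α) ∧
    αt - γ = ∑ α ∈ Δ, c α • α
  neg_highest_notMem : -αt ∉ Δ
  sum_eq : αt = ∑ β ∈ Δ, (n β : ℚ) • β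
  pos : ∀ β ∈ Δ, 0 < n β
  one : n (-αt) = 1
  dual_self : ∀ β ∈ Δ, β (ϖ β) = 1
  dual_ne : ∀ β ∈ Δ, ∀ γ ∈ Δ, γ ≠ β → γ (ϖ β) = 0
  dual_neg_highest : ϖ (-αt) = 0

/-- `p` is an interior point of the alcove, and every root takes its values on the alcove in
a unit interval whose interior contains its value at `p`. -/
def IsGeneric (R : RootSystemData V) (Δ : Finset (Module.Dual ℚ V))
    (αt : Module.Dual ℚ V) (p : V) : Prop :=
  (∀ α ∈ extFin Δ αt, 0 < wallHeight αt α p ∧ wallHeight αt α p < 1) ∧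
    ∀ β ∈ R.Φ, ∃ k : ℤ, (∀ x ∈ alcove Δ αt, k ≤ β x ∧ β x ≤ k + 1) ∧
      k < β p ∧ β p < k + 1

section

variable {Δ : Finset (Module.Dual ℚ V)} {αt : Module.Dual ℚ V}

theorem mem_extFin {α : Module.Dual ℚ V} : α ∈ extFin Δ αt ↔ α = -αt ∨ α ∈ Δ := by
  simp [extFin]

theorem coe_extFin : (extFin Δ αt : Set (Module.Dual ℚ V)) = extBase Δ αt := by
  simp [extFin, extBase]

theorem mem_extBase_iff {α : Module.Dual ℚ V} : α ∈ extBase Δ αt ↔ α ∈ extFin Δ αt := by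
  rw [← coe_extFin, Finset.mem_coe]

theorem mem_alcove_iff {x : V} :
    x ∈ alcove Δ αt ↔ ∀ α ∈ extFin Δ αt, 0 ≤ wallHeight αt α x := by
  simp [alcove, mem_extBase_iff, wallHeight]

theorem mem_IOf_iff {α : Module.Dual ℚ V} {x : V} :
    α ∈ IOf Δ αt x ↔ α ∈ extFin Δ αt ∧ wallHeight αt α x = 0 := by
  simp [IOf, mem_extBase_iff, wallHeight, sub_eq_zero]

theorem exists_int_eq_mfun (αt α : Module.Dual ℚ V) : ∃ k : ℤ, (k : ℚ) = mfun αt α := by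
  unfold mfun
  split_ifs
  · exact ⟨-1, by simp⟩
  · exact ⟨0, by simp⟩

end

namespace IsExtendedBase

variable {R : RootSystemData V} {Δ : Finset (Module.Dual ℚ V)} {αt : Module.Dual ℚ V}
  {n : Module.Dual ℚ V → ℕ} {ϖ : Module.Dual ℚ V → V}

theorem mfun_of_mem (h : IsExtendedBase R Δ αt n ϖ) {α : Module.Dual ℚ V} (hα : α ∈ Δ) :
    mfun αt α = 0 := by
  have : α ≠ -αt := by
    rintro rfl
    exact h.neg_highest_notMem hα
  simp [mfun, this]

theorem wallHeight_of_mem (h : IsExtendedBase R Δ αt n ϖ) {α : Module.Dual ℚ V} (hα : α ∈ Δ)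
    (x : V) : wallHeight αt α x = α x := by
  simp [wallHeight, h.mfun_of_mem hα]

theorem wallHeight_neg_highest (x : V) : wallHeight αt (-αt) x = 1 - αt x := by
  simp [wallHeight, mfun]
  ring

theorem mem_root (h : IsExtendedBase R Δ αt n ϖ) {α : Module.Dual ℚ V}
    (hα : α ∈ extFin Δ αt) : α ∈ R.Φ := by
  rcases mem_extFin.1 hα with rfl | hα
  · exact R.neg_mem h.highest_mem
  · exact h.subset hα

theorem n_pos (h : IsExtendedBase R Δ αt n ϖ) {α : Module.Dual ℚ V}
    (hα : α ∈ extFin Δ αt) : 0 < (n α : ℚ) := by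
  rcases mem_extFin.1 hα with rfl | hα
  · simp [h.one]
  · exact_mod_cast h.pos α hα

theorem sum_extFin (h : IsExtendedBase R Δ αt n ϖ) {M : Type*} [AddCommMonoid M]
    (f : Module.Dual ℚ V → M) :
    ∑ α ∈ extFin Δ αt, f α = f (-αt) + ∑ α ∈ Δ, f α := by
  classical
  have : extFin Δ αt = insert (-αt) Δ := by
    ext
    simp [mem_extFin]
  rw [this, Finset.sum_insert h.neg_highest_notMem]

theorem highest_apply (h : IsExtendedBase R Δ αt n ϖ) (x : V) :
    αt x = ∑ α ∈ Δ, (n α : ℚ) * α x := by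
  conv_lhs => rw [h.sum_eq]
  simp

theorem sum_mul_apply (h : IsExtendedBase R Δ αt n ϖ) (x : V) :
    ∑ α ∈ extFin Δ αt, (n α : ℚ) * α x = 0 := by
  rw [h.sum_extFin, ← h.highest_apply, h.one]
  simp

theorem sum_mul_wallHeight (h : IsExtendedBase R Δ αt n ϖ) (x : V) :
    ∑ α ∈ extFin Δ αt, (n α : ℚ) * wallHeight αt α x = 1 := by
  have : ∑ α ∈ Δ, (n α : ℚ) * wallHeight αt α x = ∑ α ∈ Δ, (n α : ℚ) * α x :=
    Finset.sum_congr rfl fun α hα => by rw [h.wallHeight_of_mem hα]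
  rw [h.sum_extFin, this, wallHeight_neg_highest, h.highest_apply, h.one]
  simp

theorem eq_of_forall_apply_eq (h : IsExtendedBase R Δ αt n ϖ) {x y : V}
    (hxy : ∀ α ∈ Δ, α x = α y) : x = y := by
  have hΦ : ∀ β ∈ R.Φ, β (x - y) = 0 := by
    intro β hβ
    obtain ⟨c, -, hc⟩ := h.nonneg_or_nonpos β hβ
    have h0 : (∑ α ∈ Δ, c α • α) (x - y) = 0 := by
      rw [LinearMap.sum_apply]
      refine Finset.sum_eq_zero fun α hα => ?_
      simp [hxy α hα]
    rcases hc with hc | hc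
    · rw [hc, h0]
    · rwa [← hc, LinearMap.neg_apply, neg_eq_zero] at h0
  rw [← sub_eq_zero, ← Module.forall_dual_apply_eq_zero_iff ℚ]
  intro φ
  have : φ ∈ Submodule.span ℚ R.Φ := R.span_eq_top ▸ Submodule.mem_top
  induction this using Submodule.span_induction with
  | mem β hβ => exact hΦ β hβ
  | zero => rfl
  | add a b _ _ ha hb => rw [LinearMap.add_apply, ha, hb, add_zero]
  | smul c a _ ha => rw [LinearMap.smul_apply, ha, smul_zero]

theorem eq_of_wallHeight_eq (h : IsExtendedBase R Δ αt n ϖ) {x y : V}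
    (hxy : ∀ α ∈ extFin Δ αt, wallHeight αt α x = wallHeight αt α y) : x = y :=
  h.eq_of_forall_apply_eq fun α hα => by
    simpa [wallHeight] using hxy α (mem_extFin.2 (Or.inr hα))

theorem apply_sum_smul (h : IsExtendedBase R Δ αt n ϖ) (f : Module.Dual ℚ V → ℚ)
    {α : Module.Dual ℚ V} (hα : α ∈ Δ) :
    α (∑ β ∈ extFin Δ αt, f β • ϖ β) = f α := by
  rw [h.sum_extFin, h.dual_neg_highest, smul_zero, zero_add, map_sum,
    Finset.sum_eq_single_of_mem α hα]
  · rw [map_smul, h.dual_self α hα, smul_eq_mul, mul_one]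
  · intro β hβ hne
    rw [map_smul, h.dual_ne β hβ α hα hne.symm, smul_zero]

/-- A vector with prescribed values of the linear forms in the extended base. -/
theorem apply_sum_smul_of_sum_eq_zero (h : IsExtendedBase R Δ αt n ϖ)
    {f : Module.Dual ℚ V → ℚ} (hf : ∑ α ∈ extFin Δ αt, (n α : ℚ) * f α = 0)
    {α : Module.Dual ℚ V} (hα : α ∈ extFin Δ αt) :
    α (∑ β ∈ extFin Δ αt, f β • ϖ β) = f α := by
  rcases mem_extFin.1 hα with rfl | hα
  · rw [LinearMap.neg_apply, h.highest_apply,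
      Finset.sum_congr rfl fun α hα => by rw [h.apply_sum_smul f hα]]
    rw [h.sum_extFin, h.one] at hf
    push_cast at hf
    linarith
  · exact h.apply_sum_smul f hα

/-- A point with prescribed barycentric coordinates. -/
theorem wallHeight_sum_smul (h : IsExtendedBase R Δ αt n ϖ)
    {f : Module.Dual ℚ V → ℚ} (hf : ∑ α ∈ extFin Δ αt, (n α : ℚ) * f α = 1)
    {α : Module.Dual ℚ V} (hα : α ∈ extFin Δ αt) :
    wallHeight αt α (∑ β ∈ extFin Δ αt, f β • ϖ β) = f α := by
  rcases mem_extFin.1 hα with rfl | hα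
  · rw [wallHeight_neg_highest, h.highest_apply,
      Finset.sum_congr rfl fun α hα => by rw [h.apply_sum_smul f hα]]
    rw [h.sum_extFin, h.one] at hf
    push_cast at hf
    linarith
  · rw [h.wallHeight_of_mem hα, h.apply_sum_smul f hα]

theorem sum_wallHeight_smul (h : IsExtendedBase R Δ αt n ϖ) (x : V) :
    ∑ β ∈ extFin Δ αt, wallHeight αt β x • ϖ β = x :=
  h.eq_of_wallHeight_eq fun _ hα => h.wallHeight_sum_smul (h.sum_mul_wallHeight x) hα

/-- The vertex of the alcove opposite to the wall of `β`. -/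
theorem wallHeight_vertex (h : IsExtendedBase R Δ αt n ϖ) {β α : Module.Dual ℚ V}
    (hβ : β ∈ extFin Δ αt) (hα : α ∈ extFin Δ αt) [Decidable (α = β)] :
    wallHeight αt α ((n β : ℚ)⁻¹ • ϖ β) = if α = β then (n β : ℚ)⁻¹ else 0 := by
  classical
  have hn := h.n_pos hβ
  have := h.wallHeight_sum_smul (f := fun γ => if γ = β then (n β : ℚ)⁻¹ else 0)
    (by simp [hβ, hn.ne']) hα
  simp only [ite_smul, zero_smul, Finset.sum_ite_eq', hβ, if_true] at this
  rw [this]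
  congr

theorem vertex_mem_alcove (h : IsExtendedBase R Δ αt n ϖ) {β : Module.Dual ℚ V}
    (hβ : β ∈ extFin Δ αt) : (n β : ℚ)⁻¹ • ϖ β ∈ alcove Δ αt := by
  classical
  rw [mem_alcove_iff]
  intro α hα
  rw [h.wallHeight_vertex hβ hα]
  split_ifs <;> positivity

/-- An affine function is determined by its values at the vertices of the alcove. -/
theorem affine_eq_sum (h : IsExtendedBase R Δ αt n ϖ) (φ : Module.Dual ℚ V) (c : ℚ) (x : V) :
    φ x + c = ∑ β ∈ extFin Δ αt,
      (n β * wallHeight αt β x) * (φ ((n β : ℚ)⁻¹ • ϖ β) + c) := by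
  simp only [mul_add, Finset.sum_add_distrib, ← Finset.sum_mul, h.sum_mul_wallHeight, one_mul]
  congr 1
  conv_lhs => rw [← h.sum_wallHeight_smul x, map_sum]
  refine Finset.sum_congr rfl fun β hβ => ?_
  have := (h.n_pos hβ).ne'
  simp only [map_smul, smul_eq_mul]
  field_simp

theorem exists_mem_alcove_wallHeight_eq_zero (h : IsExtendedBase R Δ αt n ϖ)
    (α : Module.Dual ℚ V) (hα : α ∈ extFin Δ αt) :
    ∃ u : V, wallHeight αt α u = 0 ∧
      ∀ β ∈ extFin Δ αt, β ≠ α → 0 < wallHeight αt β u := by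
  classical
  obtain ⟨γ, hγ, hne⟩ : ∃ γ ∈ extFin Δ αt, γ ≠ α := by
    by_contra! hall
    have h0 : ∀ x, α x = 0 := by
      intro x
      have hs := h.sum_mul_apply x
      rw [Finset.sum_eq_single_of_mem α hα fun β hβ hne => absurd (hall β hβ) hne] at hs
      exact (mul_eq_zero.1 hs).resolve_left (h.n_pos hα).ne'
    exact R.ne_zero (h.mem_root hα) (LinearMap.ext h0)
  set N : ℚ := ∑ β ∈ (extFin Δ αt).erase α, (n β : ℚ) with hN
  have hNpos : 0 < N :=
    Finset.sum_pos (fun β hβ => h.n_pos (Finset.mem_of_mem_erase hβ))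
      ⟨γ, Finset.mem_erase.2 ⟨hne, hγ⟩⟩
  have hsum : ∑ β ∈ extFin Δ αt, (n β : ℚ) * (if β = α then 0 else N⁻¹) = 1 := by
    rw [← Finset.add_sum_erase _ _ hα, if_pos rfl, mul_zero, zero_add,
      Finset.sum_congr rfl fun β hβ => by rw [if_neg (Finset.ne_of_mem_erase hβ)],
      ← Finset.sum_mul, mul_inv_cancel₀ hNpos.ne']
  refine ⟨∑ β ∈ extFin Δ αt, (if β = α then 0 else N⁻¹) • ϖ β, ?_, fun β hβ hne => ?_⟩
  · rw [h.wallHeight_sum_smul hsum hα, if_pos rfl]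
  · rw [h.wallHeight_sum_smul hsum hβ, if_neg hne]
    positivity

theorem exists_isGeneric (h : IsExtendedBase R Δ αt n ϖ) :
    ∃ p : V, IsGeneric R Δ αt p := by
  set N : ℚ := ∑ β ∈ extFin Δ αt, (n β : ℚ) with hN
  have hα₀ : -αt ∈ extFin Δ αt := mem_extFin.2 (Or.inl rfl)
  have hNpos : 0 < N := Finset.sum_pos (fun β hβ => h.n_pos hβ) ⟨_, hα₀⟩
  have hsum : ∑ β ∈ extFin Δ αt, (n β : ℚ) * N⁻¹ = 1 := by
    rw [← Finset.sum_mul, mul_inv_cancel₀ hNpos.ne']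
  obtain ⟨p, hp⟩ : ∃ p : V, ∀ α ∈ extFin Δ αt, wallHeight αt α p = N⁻¹ :=
    ⟨_, fun α hα => h.wallHeight_sum_smul hsum hα⟩
  have hpΔ : ∀ α ∈ Δ, α p = N⁻¹ := fun α hα => by
    rw [← h.wallHeight_of_mem hα, hp α (mem_extFin.2 (Or.inr hα))]
  have hp₀ : αt p = 1 - N⁻¹ := by
    have := hp _ hα₀
    rw [wallHeight_neg_highest] at this
    linarith
  have hinv : 0 < N⁻¹ := inv_pos.2 hNpos
  have hinv1 : N⁻¹ < 1 := by
    have h1 : αt p = ∑ α ∈ Δ, (n α : ℚ) * N⁻¹ := by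
      rw [h.highest_apply]
      exact Finset.sum_congr rfl fun α hα => by rw [hpΔ α hα]
    have hne : Δ.Nonempty := by
      rw [Finset.nonempty_iff_ne_empty]
      rintro rfl
      exact R.ne_zero h.highest_mem (by simpa using h.sum_eq)
    have h2 : 0 < αt p := by
      rw [h1]
      exact Finset.sum_pos (fun α hα => mul_pos (by exact_mod_cast h.pos α hα) hinv) hne
    linarith
  have key : ∀ β ∈ R.Φ, ∀ c : Module.Dual ℚ V → ℚ, (∀ α ∈ Δ, 0 ≤ c α) →
      β = ∑ α ∈ Δ, c α • α →
      (∀ x ∈ alcove Δ αt, 0 ≤ β x ∧ β x ≤ 1) ∧ 0 < β p ∧ β p < 1 := by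
    intro β hβ c hc hβc
    obtain ⟨d, hd, hβd⟩ := h.highest β hβ
    have comb : ∀ e : Module.Dual ℚ V → ℚ, (∀ α ∈ Δ, 0 ≤ e α) → ∀ x : V,
        (∀ α ∈ Δ, 0 ≤ α x) → 0 ≤ (∑ α ∈ Δ, e α • α) x := by
      intro e he x hx
      rw [LinearMap.sum_apply]
      exact Finset.sum_nonneg fun α hα => mul_nonneg (he α hα) (hx α hα)
    have hle : ∀ x : V, (∀ α ∈ Δ, 0 ≤ α x) → β x ≤ αt x := by
      intro x hx
      have := comb d hd x hx
      rw [← hβd, LinearMap.sub_apply] at this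
      linarith
    have hpnn : ∀ α ∈ Δ, 0 ≤ α p := fun α hα => (hpΔ α hα).symm ▸ hinv.le
    refine ⟨fun x hx => ?_, ?_, ?_⟩
    · rw [mem_alcove_iff] at hx
      have hx' : ∀ α ∈ Δ, 0 ≤ α x := fun α hα => by
        rw [← h.wallHeight_of_mem hα]
        exact hx α (mem_extFin.2 (Or.inr hα))
      have h1 := hx _ hα₀
      rw [wallHeight_neg_highest] at h1
      have h2 := hle x hx'
      refine ⟨?_, by linarith⟩
      rw [hβc]
      exact comb c hc x hx'
    · have hnn : 0 ≤ β p := hβc ▸ comb c hc p hpnn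
      refine lt_of_le_of_ne hnn fun h0 => R.ne_zero hβ ?_
      have hs : ∑ α ∈ Δ, c α * N⁻¹ = 0 := by
        rw [h0, hβc, LinearMap.sum_apply]
        refine Finset.sum_congr rfl fun α hα => ?_
        rw [LinearMap.smul_apply, hpΔ α hα, smul_eq_mul]
      rw [Finset.sum_eq_zero_iff_of_nonneg fun α hα => mul_nonneg (hc α hα) hinv.le] at hs
      rw [hβc]
      refine Finset.sum_eq_zero fun α hα => ?_
      rw [(mul_eq_zero.1 (hs α hα)).resolve_right hinv.ne', zero_smul]
    · have := hle p hpnn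
      linarith
  refine ⟨p, fun α hα => by rw [hp α hα]; exact ⟨hinv, hinv1⟩, fun β hβ => ?_⟩
  obtain ⟨c, hc, hβc | hβc⟩ := h.nonneg_or_nonpos β hβ
  · have := key β hβ c hc hβc
    refine ⟨0, ?_⟩
    simpa using this
  · obtain ⟨h1, h2, h3⟩ := key (-β) (R.neg_mem hβ) c hc hβc
    refine ⟨-1, fun x hx => ?_, ?_⟩
    · have := h1 x hx
      rw [LinearMap.neg_apply] at this
      push_cast
      constructor <;> linarith
    · rw [LinearMap.neg_apply] at h2 h3
      push_cast
      constructor <;> linarith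

end IsExtendedBase

/-! ### The extended affine Weyl group -/

namespace IsExtendedBase

variable {R : RootSystemData V} {Δ : Finset (Module.Dual ℚ V)} {αt : Module.Dual ℚ V}
  {n : Module.Dual ℚ V → ℕ} {ϖ : Module.Dual ℚ V → V} {L : AddSubgroup V}

theorem exists_int_wallHeight_apply (h : IsExtendedBase R Δ αt n ϖ) {p : V}
    (hp : IsGeneric R Δ αt p) {z : V ≃ₗ[ℚ] V} (hz : z ∈ weyl R) {v : V}
    (hv : v ∈ coweightSet R) {α : Module.Dual ℚ V} (hα : α ∈ extFin Δ αt) :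
    ∃ k : ℤ, (∀ x ∈ alcove Δ αt, k ≤ wallHeight αt α (z x + v) ∧
      wallHeight αt α (z x + v) ≤ k + 1) ∧
      k < wallHeight αt α (z p + v) ∧ wallHeight αt α (z p + v) < k + 1 := by
  obtain ⟨k, hk, hkp⟩ := hp.2 _ (R.comp_mem hz α (h.mem_root hα)).1
  simp only [LinearMap.comp_apply, LinearEquiv.coe_coe] at hk hkp
  obtain ⟨a, ha⟩ := hv α (h.mem_root hα)
  obtain ⟨b, hb⟩ := exists_int_eq_mfun αt α
  have e : ∀ x, wallHeight αt α (z x + v) = α (z x) + a - b := by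
    intro x
    simp [wallHeight, ha, hb]
  refine ⟨k + a - b, fun x hx => ?_, ?_⟩
  · have := hk x hx
    rw [e]
    push_cast
    constructor <;> linarith
  · rw [e]
    push_cast
    constructor <;> linarith

theorem map_alcove (h : IsExtendedBase R Δ αt n ϖ) {p : V}
    (hp : IsGeneric R Δ αt p) {z : V ≃ₗ[ℚ] V} (hz : z ∈ weyl R) {v : V}
    (hv : v ∈ coweightSet R) (hpC : z p + v ∈ alcove Δ αt) {x : V} (hx : x ∈ alcove Δ αt) :
    z x + v ∈ alcove Δ αt := by
  rw [mem_alcove_iff] at hpC ⊢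
  intro α hα
  obtain ⟨k, hk, hkp⟩ := h.exists_int_wallHeight_apply hp hz hv hα
  have h1 := hpC α hα
  have h2 : (-1 : ℚ) < k := by linarith
  have h3 : (0 : ℤ) ≤ k := by
    have : (-1 : ℤ) < k := by exact_mod_cast h2
    omega
  have h4 : (0 : ℚ) ≤ k := by exact_mod_cast h3
  linarith [(hk x hx).1]

theorem map_symm_alcove (h : IsExtendedBase R Δ αt n ϖ) {p : V}
    (hp : IsGeneric R Δ αt p) {z : V ≃ₗ[ℚ] V} (hz : z ∈ weyl R) {v : V}
    (hv : z⁻¹ v ∈ coweightSet R) (hpC : z p + v ∈ alcove Δ αt) {x : V}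
    (hx : x ∈ alcove Δ αt) : z⁻¹ (x - v) ∈ alcove Δ αt := by
  have hv' : -(z⁻¹ v) ∈ coweightSet R := fun α hα => by
    obtain ⟨k, hk⟩ := hv α hα
    exact ⟨-k, by simp [hk]⟩
  rw [mem_alcove_iff]
  intro α hα
  obtain ⟨k, hk, -⟩ := h.exists_int_wallHeight_apply hp (inv_mem hz) hv' hα
  have h1 := hk _ hpC
  have e : z⁻¹ (z p + v) + -(z⁻¹ v) = p := by
    rw [map_add, ← LinearEquiv.mul_apply, inv_mul_cancel]
    simp
  rw [e] at h1
  have h2 := hp.1 α hα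
  have h3 : (0 : ℤ) ≤ k := by
    have : (0 : ℚ) < ((k + 1 : ℤ) : ℚ) := by
      push_cast
      linarith
    have : (0 : ℤ) < k + 1 := by exact_mod_cast this
    omega
  have h4 : (0 : ℚ) ≤ k := by exact_mod_cast h3
  have h5 := (hk x hx).1
  rw [map_sub, sub_eq_add_neg]
  linarith

/-- An affine map preserving the alcove, with linear part in the Weyl group, permutes the
extended base. -/
theorem dact_mem_extFin (h : IsExtendedBase R Δ αt n ϖ) {z : V ≃ₗ[ℚ] V} (hz : z ∈ weyl R)
    {v : V} (hC : ∀ x ∈ alcove Δ αt, z x + v ∈ alcove Δ αt)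
    (hC' : ∀ x ∈ alcove Δ αt, z⁻¹ (x - v) ∈ alcove Δ αt) {α : Module.Dual ℚ V}
    (hα : α ∈ extFin Δ αt) : dact z α ∈ extFin Δ αt := by
  classical
  obtain ⟨u, hu0, hu⟩ := h.exists_mem_alcove_wallHeight_eq_zero α hα
  have huC : u ∈ alcove Δ αt := mem_alcove_iff.2 fun β hβ => by
    by_cases hβα : β = α
    · rw [hβα, hu0]
    · exact (hu β hβ hβα).le
  have hinv : ∀ x, z⁻¹ (z x + v - v) = x := fun x => by
    rw [add_sub_cancel_right]
    exact z.symm_apply_apply x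
  obtain ⟨α', hα', hy⟩ : ∃ α' ∈ extFin Δ αt, wallHeight αt α' (z u + v) = 0 := by
    by_contra! hne
    have hypos : ∀ β ∈ extFin Δ αt, 0 < wallHeight αt β (z u + v) := fun β hβ =>
      lt_of_le_of_ne (mem_alcove_iff.1 (hC u huC) β hβ) (hne β hβ).symm
    set φ : Module.Dual ℚ V := dact z α with hφ
    set c : ℚ := -φ v - mfun αt α with hc
    have hφc : ∀ x, φ x + c = wallHeight αt α (z⁻¹ (x - v)) := by
      intro x
      rw [hc, wallHeight, map_sub, map_sub]
      change φ x + (-φ v - mfun αt α) = φ x - φ v - mfun αt α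
      ring
    have hnonneg : ∀ β ∈ extFin Δ αt, 0 ≤ φ ((n β : ℚ)⁻¹ • ϖ β) + c := fun β hβ => by
      rw [hφc]
      exact mem_alcove_iff.1 (hC' _ (h.vertex_mem_alcove hβ)) α hα
    have h0 := h.affine_eq_sum φ c (z u + v)
    rw [hφc, hinv, hu0, eq_comm, Finset.sum_eq_zero_iff_of_nonneg fun β hβ =>
      mul_nonneg (mul_nonneg (h.n_pos hβ).le (hypos β hβ).le) (hnonneg β hβ)] at h0
    have hvert : ∀ β ∈ extFin Δ αt, φ ((n β : ℚ)⁻¹ • ϖ β) + c = 0 := fun β hβ =>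
      (mul_eq_zero.1 (h0 β hβ)).resolve_left (mul_pos (h.n_pos hβ) (hypos β hβ)).ne'
    have h1 := h.affine_eq_sum φ c (z ((n α : ℚ)⁻¹ • ϖ α) + v)
    rw [hφc, hinv, h.wallHeight_vertex hα hα, if_pos rfl,
      Finset.sum_eq_zero fun β hβ => by rw [hvert β hβ, mul_zero]] at h1
    exact (inv_pos.2 (h.n_pos hα)).ne' h1
  set γ : Module.Dual ℚ V := α'.comp z.toLinearMap with hγ
  set c : ℚ := α' v - mfun αt α' with hc
  have hγc : ∀ x, γ x + c = wallHeight αt α' (z x + v) := by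
    intro x
    rw [hc, wallHeight, map_add]
    change α' (z x) + _ = _
    ring
  have hnonneg : ∀ β ∈ extFin Δ αt, 0 ≤ γ ((n β : ℚ)⁻¹ • ϖ β) + c := fun β hβ => by
    rw [hγc]
    exact mem_alcove_iff.1 (hC _ (h.vertex_mem_alcove hβ)) α' hα'
  have h0 := h.affine_eq_sum γ c u
  rw [hγc, hy, eq_comm, Finset.sum_eq_zero_iff_of_nonneg fun β hβ =>
    mul_nonneg (mul_nonneg (h.n_pos hβ).le (mem_alcove_iff.1 huC β hβ)) (hnonneg β hβ)] at h0
  have hvert : ∀ β ∈ extFin Δ αt, β ≠ α → γ ((n β : ℚ)⁻¹ • ϖ β) + c = 0 := fun β hβ hne =>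
    (mul_eq_zero.1 (h0 β hβ)).resolve_left (mul_pos (h.n_pos hβ) (hu β hβ hne)).ne'
  set a : ℚ := n α * (γ ((n α : ℚ)⁻¹ • ϖ α) + c) with ha
  have hform : ∀ x, γ x + c = a * wallHeight αt α x := by
    intro x
    rw [h.affine_eq_sum γ c x, Finset.sum_eq_single_of_mem α hα fun β hβ hne => by
      rw [hvert β hβ hne, mul_zero]]
    rw [ha]
    ring
  have hγa : γ = a • α := by
    ext x
    have h1 := hform x
    have h2 := hform 0
    simp only [wallHeight, map_zero] at h1 h2
    rw [LinearMap.smul_apply, smul_eq_mul]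
    linarith
  have ha0 : 0 ≤ a := mul_nonneg (h.n_pos hα).le (hnonneg α hα)
  have hγΦ : a • α ∈ R.Φ := hγa ▸ (R.comp_mem hz α' (h.mem_root hα')).1
  have ha1 : a = 1 := (R.reduced α (h.mem_root hα) a hγΦ).resolve_right (by linarith)
  have : dact z α = α' := by
    ext x
    have h1 := LinearMap.congr_fun hγa (z.symm x)
    rw [ha1, one_smul] at h1
    rw [dact_apply, ← h1]
    change α' (z (z.symm x)) = _
    rw [z.apply_symm_apply]
  exact this ▸ hα'

theorem mem_AutTildeL (h : IsExtendedBase R Δ αt n ϖ) {z : V ≃ₗ[ℚ] V} (hz : z ∈ weyl R)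
    {v : V} (hv : v ∈ L) (hC : ∀ x ∈ alcove Δ αt, z x + v ∈ alcove Δ αt)
    (hC' : ∀ x ∈ alcove Δ αt, z⁻¹ (x - v) ∈ alcove Δ αt) : z ∈ AutTildeL R Δ αt L := by
  classical
  refine ⟨⟨hz, ?_⟩, v, hv, ?_⟩
  · rw [← coe_extFin, ← Finset.coe_image, Finset.coe_inj]
    refine Finset.eq_of_subset_of_card_le ?_ ?_
    · exact Finset.image_subset_iff.2 fun α hα => h.dact_mem_extFin hz hC hC' hα
    · rw [Finset.card_image_of_injective _ (dact_injective z)]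
  · refine subset_antisymm (Set.image_subset_iff.2 hC) fun x hx => ⟨_, hC' x hx, ?_⟩
    change z (z.symm (x - v)) + v = x
    rw [z.apply_symm_apply, sub_add_cancel]

theorem dact_mem_of_mem_AutTildeL {z : V ≃ₗ[ℚ] V} (hz : z ∈ AutTildeL R Δ αt L)
    {α : Module.Dual ℚ V} (hα : α ∈ extFin Δ αt) : dact z α ∈ extFin Δ αt := by
  rw [← mem_extBase_iff] at hα ⊢
  exact hz.1.2 ▸ Set.mem_image_of_mem _ hα

theorem wallHeight_dact (h : IsExtendedBase R Δ αt n ϖ) {z : V ≃ₗ[ℚ] V}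
    (hz : z ∈ AutTildeL R Δ αt L) {v : V}
    (hv : (fun x => z x + v) '' alcove Δ αt = alcove Δ αt) {α : Module.Dual ℚ V}
    (hα : α ∈ extFin Δ αt) (x : V) :
    wallHeight αt (dact z α) (z x + v) = wallHeight αt α x := by
  have hα' := dact_mem_of_mem_AutTildeL hz hα
  set c : ℚ := dact z α v - mfun αt (dact z α) + mfun αt α with hc
  have e : ∀ x, wallHeight αt (dact z α) (z x + v) = wallHeight αt α x + c := by
    intro x
    rw [wallHeight, wallHeight, map_add, dact_apply_apply, hc]
    ring
  have hC : ∀ x ∈ alcove Δ αt, z x + v ∈ alcove Δ αt := fun x hx =>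
    hv ▸ Set.mem_image_of_mem _ hx
  have facet : ∀ β ∈ extFin Δ αt, ∃ u ∈ alcove Δ αt, wallHeight αt β u = 0 := by
    intro β hβ
    obtain ⟨u, hu0, hu⟩ := h.exists_mem_alcove_wallHeight_eq_zero β hβ
    refine ⟨u, mem_alcove_iff.2 fun γ hγ => ?_, hu0⟩
    by_cases hγβ : γ = β
    · rw [hγβ, hu0]
    · exact (hu γ hγ hγβ).le
  have hc0 : c = 0 := by
    apply le_antisymm
    · obtain ⟨y, hy, hy0⟩ := facet _ hα'
      obtain ⟨x, hx, rfl⟩ := hv.symm ▸ hy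
      have h1 := e x
      have h2 := mem_alcove_iff.1 hx α hα
      simp only at hy0
      linarith
    · obtain ⟨u, hu, hu0⟩ := facet _ hα
      have h1 := e u
      have h2 := mem_alcove_iff.1 (hC u hu) _ hα'
      linarith
  rw [e, hc0, add_zero]

theorem n_dact (h : IsExtendedBase R Δ αt n ϖ) {z : V ≃ₗ[ℚ] V}
    (hz : z ∈ AutTildeL R Δ αt L) {α : Module.Dual ℚ V} (hα : α ∈ extFin Δ αt) :
    n (dact z α) = n α := by
  classical
  obtain ⟨-, v, -, hv⟩ := id hz
  have hα' := dact_mem_of_mem_AutTildeL hz hα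
  have h1 := h.sum_mul_wallHeight (z ((n α : ℚ)⁻¹ • ϖ α) + v)
  rw [Finset.sum_eq_single_of_mem _ hα', h.wallHeight_dact hz hv hα,
    h.wallHeight_vertex hα hα, if_pos rfl, ← div_eq_mul_inv, div_eq_one_iff_eq] at h1
  · exact_mod_cast h1
  · exact (h.n_pos hα).ne'
  · intro β hβ hne
    have hβ' := mem_extBase_iff.2 hβ
    rw [← hz.1.2] at hβ'
    obtain ⟨γ, hγ, rfl⟩ := hβ'
    rw [mem_extBase_iff] at hγ
    have : γ ≠ α := fun hγα => hne (hγα ▸ rfl)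
    rw [h.wallHeight_dact hz hv hγ, h.wallHeight_vertex hα hγ, if_neg this, mul_zero]

/-- If an affine reflection in a wall does not bring a point closer to a generic point of the
alcove, then the point lies on the same side of the wall as the alcove. -/
theorem wallHeight_nonneg_of_normSq_le (h : IsExtendedBase R Δ αt n ϖ) {p : V}
    (hp : IsGeneric R Δ αt p) {α : Module.Dual ℚ V} (hα : α ∈ extFin Δ αt) {x : V}
    (hx : R.normSq (x - p) ≤ R.normSq (x - wallHeight αt α x • R.coroot α - p)) :
    0 ≤ wallHeight αt α x := by
  have hpos := R.normSq_coroot_pos (h.mem_root hα)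
  rw [sub_right_comm, R.normSq_sub_smul_coroot (h.mem_root hα)] at hx
  have e : wallHeight αt α x - α (x - p) = wallHeight αt α p := by
    rw [wallHeight, wallHeight, map_sub]
    ring
  rw [e] at hx
  by_contra! hneg
  have := mul_pos hpos (mul_pos (neg_pos.2 hneg) (hp.1 α hα).1)
  linarith

theorem exists_mem_alcove (h : IsExtendedBase R Δ αt n ϖ)
    (hQL : (corootLattice R : Set V) ⊆ L) (hLP : (L : Set V) ⊆ coweightSet R) (x : V) :
    ∃ w ∈ weyl R, ∃ l ∈ L, w x + l ∈ alcove Δ αt := by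
  obtain ⟨p, hp⟩ := h.exists_isGeneric
  obtain ⟨_, ⟨w, hw, l, hl, rfl⟩, hmin⟩ := R.exists_closest
    (S := {y | ∃ w ∈ weyl R, ∃ l ∈ L, y = w x + l}) ⟨_, 1, one_mem _, 0, zero_mem _, rfl⟩ x p
    (by
      rintro _ ⟨w, hw, l, hl, rfl⟩ α hα
      obtain ⟨k, hk⟩ := hLP hl α hα
      exact ⟨_, (R.comp_mem hw α hα).1, k, by simp [hk]⟩)
  refine ⟨w, hw, l, hl, mem_alcove_iff.2 fun α hα =>
    h.wallHeight_nonneg_of_normSq_le hp hα (hmin _ ?_)⟩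
  have hαΦ := h.mem_root hα
  have hs : R.refl hαΦ ∈ weyl R := R.refl_mem_weylOf hαΦ hαΦ
  obtain ⟨k, hk⟩ := exists_int_eq_mfun αt α
  refine ⟨R.refl hαΦ * w, mul_mem hs hw, R.refl hαΦ l + k • R.coroot α,
    add_mem (R.apply_mem_of_weyl hQL hLP hs hl)
      (zsmul_mem (hQL (R.coroot_mem hαΦ)) k), ?_⟩
  rw [LinearEquiv.mul_apply, R.refl_apply, R.refl_apply, wallHeight, ← hk, map_add,
    ← Int.cast_smul_eq_zsmul ℚ]
  module

/-- An element of the extended affine Weyl group sending a point `y` of the alcove into the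
alcove is the product of a symmetry of the alcove and an element of the group generated by the
reflections in the walls through `y`. -/
theorem exists_decomposition (h : IsExtendedBase R Δ αt n ϖ)
    (hQL : (corootLattice R : Set V) ⊆ L) (hLP : (L : Set V) ⊆ coweightSet R)
    {w : V ≃ₗ[ℚ] V} (hw : w ∈ weyl R) {l : V} (hl : l ∈ L) {y : V}
    (hy : y ∈ alcove Δ αt) (hwy : w y + l ∈ alcove Δ αt) :
    ∃ w' ∈ weylOf R (IOf Δ αt y), ∃ z ∈ AutTildeL R Δ αt L, w = z * w' ∧
      ∃ v, (fun x => z x + v) '' alcove Δ αt = alcove Δ αt ∧ z y + v = w y + l := by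
  obtain ⟨p, hp⟩ := h.exists_isGeneric
  have hI : IOf Δ αt y ⊆ R.Φ := fun α hα => h.mem_root (mem_IOf_iff.1 hα).1
  have hIint : ∀ α ∈ IOf Δ αt y, ∃ k : ℤ, (k : ℚ) = α y := fun α hα => by
    rw [hα.2]
    exact exists_int_eq_mfun αt α
  have hWI := R.weylOf_le hI
  have hfix : ∀ w' ∈ weylOf R (IOf Δ αt y), w' y - y ∈ L := fun w' hw' =>
    hQL (R.sub_mem_corootLattice hI hw' y hIint).1
  obtain ⟨_, ⟨w', hw', rfl⟩, hmin⟩ := R.exists_closest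
    (S := {q | ∃ w' ∈ weylOf R (IOf Δ αt y), q = y + w' (w⁻¹ (p - l) - y)})
    ⟨_, 1, one_mem _, rfl⟩ p p
    (by
      rintro _ ⟨w', hw', rfl⟩ α hα
      have hm : w' (w⁻¹ l) + (w' y - y) ∈ L := add_mem
        (R.apply_mem_of_weyl hQL hLP (hWI hw')
          (R.apply_mem_of_weyl hQL hLP (inv_mem hw) hl)) (hfix w' hw')
      obtain ⟨k, hk⟩ := hLP hm α hα
      refine ⟨_, (R.comp_mem (mul_mem (hWI hw') (inv_mem hw)) α hα).1, -k, ?_⟩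
      push_cast
      rw [hk, ← sub_eq_add_neg]
      change _ = α (w' (w⁻¹ p)) - _
      simp only [map_sub, map_add]
      ring)
  set g : V ≃ₗ[ℚ] V := w' * w⁻¹ with hg
  set m : V := -(w' (w⁻¹ l) + (w' y - y)) with hm
  have hgW : g ∈ weyl R := mul_mem (hWI hw') (inv_mem hw)
  have hmL : m ∈ L := neg_mem (add_mem
        (R.apply_mem_of_weyl hQL hLP (hWI hw')
          (R.apply_mem_of_weyl hQL hLP (inv_mem hw) hl)) (hfix w' hw'))
  have hgx : ∀ x, y + w' (w⁻¹ (x - l) - y) = g x + m := by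
    intro x
    rw [hg, hm, LinearEquiv.mul_apply]
    simp only [map_sub]
    abel
  have hgy : g (w y + l) + m = y := by
    rw [← hgx, add_sub_cancel_right]
    change y + w' (w.symm (w y) - y) = y
    simp
  rw [hgx] at hmin
  have hgp : g p + m ∈ alcove Δ αt := by
    rw [mem_alcove_iff]
    intro α hα
    by_cases h0 : wallHeight αt α y = 0
    · have hαI : α ∈ IOf Δ αt y := mem_IOf_iff.2 ⟨hα, h0⟩
      have hαΦ := hI hαI
      refine h.wallHeight_nonneg_of_normSq_le hp hα (hmin _ ⟨R.refl hαΦ * w',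
        mul_mem (R.refl_mem_weylOf hαΦ hαI) hw', ?_⟩)
      have e : wallHeight αt α (g p + m) = α (w' (w⁻¹ (p - l) - y)) := by
        rw [← hgx]
        rw [wallHeight, sub_eq_zero] at h0
        rw [wallHeight, map_add, h0]
        ring
      rw [e, ← hgx, LinearEquiv.mul_apply, R.refl_apply]
      abel
    · obtain ⟨k, hk, hkp⟩ := h.exists_int_wallHeight_apply hp hgW (hLP hmL) hα
      have h1 := (hk _ hwy).2
      rw [hgy] at h1
      have h2 := lt_of_le_of_ne (mem_alcove_iff.1 hy α hα) (Ne.symm h0)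
      have h3 : (0 : ℚ) < ((k + 1 : ℤ) : ℚ) := by
        push_cast
        linarith
      have h4 : (0 : ℤ) ≤ k := by
        have : (0 : ℤ) < k + 1 := by exact_mod_cast h3
        omega
      have h5 : (0 : ℚ) ≤ k := by exact_mod_cast h4
      linarith
  have hgmL : g⁻¹ m ∈ L := R.apply_mem_of_weyl hQL hLP (inv_mem hgW) hmL
  have hC : ∀ x ∈ alcove Δ αt, g x + m ∈ alcove Δ αt := fun x hx =>
    h.map_alcove hp hgW (hLP hmL) hgp hx
  have hC' : ∀ x ∈ alcove Δ αt, g⁻¹ x + -(g⁻¹ m) ∈ alcove Δ αt := fun x hx => by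
    have := h.map_symm_alcove hp hgW (hLP hgmL) hgp hx
    rwa [map_sub, sub_eq_add_neg] at this
  have hgg : ∀ x, g⁻¹⁻¹ (x - -(g⁻¹ m)) = g x + m := by
    intro x
    rw [inv_inv, sub_neg_eq_add, map_add]
    congr 1
    exact g.apply_symm_apply m
  have hgg' : ∀ x, g⁻¹ (g x + m) + -(g⁻¹ m) = x := by
    intro x
    rw [map_add, add_neg_cancel_right]
    exact g.symm_apply_apply x
  refine ⟨w', hw', g⁻¹, h.mem_AutTildeL (inv_mem hgW) (neg_mem hgmL) hC' fun x hx => ?_, ?_,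
    -(g⁻¹ m), ?_, ?_⟩
  · rw [hgg]
    exact hC x hx
  · rw [hg]
    group
  · exact subset_antisymm (Set.image_subset_iff.2 hC') fun x hx => ⟨_, hC x hx, hgg' x⟩
  · conv_lhs => rw [← hgy]
    exact hgg' _

end IsExtendedBase

/-! ### Quasi-isolated elements -/

theorem IsQuasiIsolated.conj {R : RootSystemData V} {L : AddSubgroup V}
    (hQL : (corootLattice R : Set V) ⊆ L) (hLP : (L : Set V) ⊆ coweightSet R) {x : V}
    (hx : IsQuasiIsolated R L x) {w : V ≃ₗ[ℚ] V} (hw : w ∈ weyl R) {l : V} (hl : l ∈ L) :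
    IsQuasiIsolated R L (w x + l) := by
  rw [IsQuasiIsolated, eq_bot_iff]
  intro u hu
  have hmem : w⁻¹ u ∈ fixedSub {w : V ≃ₗ[ℚ] V | w ∈ weyl R ∧ w x - x ∈ L} := by
    rintro w₁ ⟨hw₁, hw₁x⟩
    have hc : w * w₁ * w⁻¹ ∈ weyl R := mul_mem (mul_mem hw hw₁) (inv_mem hw)
    have hinv : ∀ y, w⁻¹ (w y) = y := w.symm_apply_apply
    have := hu (w * w₁ * w⁻¹) ⟨hc, by
      have e : (w * w₁ * w⁻¹) (w x + l) - (w x + l)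
          = w (w₁ x - x) + ((w * w₁ * w⁻¹) l - l) := by
        simp only [LinearEquiv.mul_apply, map_add, map_sub, hinv]
        abel
      rw [e]
      exact add_mem (R.apply_mem_of_weyl hQL hLP hw hw₁x)
        (sub_mem (R.apply_mem_of_weyl hQL hLP hc hl) hl)⟩
    conv_rhs => rw [← this]
    rw [LinearEquiv.mul_apply, LinearEquiv.mul_apply, hinv]
  rw [IsQuasiIsolated] at hx
  rw [hx, Submodule.mem_bot] at hmem
  rw [Submodule.mem_bot]
  exact (LinearEquiv.map_eq_zero_iff w⁻¹).1 hmem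

namespace IsExtendedBase

variable {R : RootSystemData V} {Δ : Finset (Module.Dual ℚ V)} {αt : Module.Dual ℚ V}
  {n : Module.Dual ℚ V → ℕ} {ϖ : Module.Dual ℚ V → V} {L : AddSubgroup V}

theorem n_eq_of_mem_QSetOf (h : IsExtendedBase R Δ αt n ϖ) {Ω : Set (Module.Dual ℚ V)}
    (hΩ : Ω ∈ QSetOf R Δ αt L) {α β : Module.Dual ℚ V} (hα : α ∈ Ω) (hβ : β ∈ Ω) :
    n α = n β := by
  obtain ⟨z, hz, -, rfl⟩ := hΩ.2.2 α hα β hβ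
  exact (h.n_dact hz (mem_extBase_iff.1 (hΩ.1 hα))).symm

open Classical in
theorem wallHeight_lamOf (h : IsExtendedBase R Δ αt n ϖ) {Ω : Set (Module.Dual ℚ V)}
    (hΩ : Ω ∈ QSetOf R Δ αt L) {α : Module.Dual ℚ V} (hα : α ∈ extFin Δ αt) :
    wallHeight αt α (lamOf n ϖ Ω)
      = if α ∈ Ω then ((n α : ℚ) * (Ω.ncard : ℚ))⁻¹ else 0 := by
  set F : Finset (Module.Dual ℚ V) := {α ∈ extFin Δ αt | α ∈ Ω} with hF
  have hFΩ : (F : Set (Module.Dual ℚ V)) = Ω := by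
    ext β
    simp only [hF, Finset.coe_filter, Set.mem_ofPred_eq, and_iff_right_iff_imp]
    exact fun hβ => mem_extBase_iff.1 (hΩ.1 hβ)
  have hcard : Ω.ncard = F.card := by
    rw [← hFΩ, Set.ncard_coe_finset]
  have hF0 : (F.card : ℚ) ≠ 0 := by
    have : F.Nonempty := by
      rw [← Finset.coe_nonempty, hFΩ]
      exact hΩ.2.1
    exact_mod_cast this.card_pos.ne'
  have hlam : lamOf n ϖ Ω = ∑ β ∈ extFin Δ αt,
      (if β ∈ Ω then ((n β : ℚ) * (Ω.ncard : ℚ))⁻¹ else 0) • ϖ β := by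
    rw [lamOf]
    simp only [ite_smul, zero_smul]
    rw [← Finset.sum_filter, ← finsum_mem_coe_finset, hFΩ]
  rw [hlam]
  refine h.wallHeight_sum_smul ?_ hα
  simp only [mul_ite, mul_zero]
  rw [← Finset.sum_filter, Finset.sum_congr rfl (g := fun _ => (F.card : ℚ)⁻¹),
    Finset.sum_const, nsmul_eq_mul, mul_inv_cancel₀ hF0]
  intro β hβ
  have := (h.n_pos (Finset.mem_filter.1 hβ).1).ne'
  rw [hcard, mul_inv, ← mul_assoc, mul_inv_cancel₀ this, one_mul]

theorem ncard_pos_of_mem_QSetOf {Ω : Set (Module.Dual ℚ V)} (hΩ : Ω ∈ QSetOf R Δ αt L) :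
    0 < Ω.ncard := by
  refine (Set.ncard_pos ?_).2 hΩ.2.1
  exact (coe_extFin (Δ := Δ) (αt := αt) ▸ Finset.finite_toSet _).subset hΩ.1

theorem lamOf_mem_alcove (h : IsExtendedBase R Δ αt n ϖ) {Ω : Set (Module.Dual ℚ V)}
    (hΩ : Ω ∈ QSetOf R Δ αt L) : lamOf n ϖ Ω ∈ alcove Δ αt := by
  classical
  rw [mem_alcove_iff]
  intro α hα
  rw [h.wallHeight_lamOf hΩ hα]
  split_ifs <;> positivity

theorem mem_iff_wallHeight_lamOf (h : IsExtendedBase R Δ αt n ϖ)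
    {Ω : Set (Module.Dual ℚ V)} (hΩ : Ω ∈ QSetOf R Δ αt L) {α : Module.Dual ℚ V}
    (hα : α ∈ extFin Δ αt) : α ∈ Ω ↔ wallHeight αt α (lamOf n ϖ Ω) ≠ 0 := by
  classical
  rw [h.wallHeight_lamOf hΩ hα]
  have h1 := (h.n_pos hα).ne'
  have h2 : (Ω.ncard : ℚ) ≠ 0 := by exact_mod_cast (ncard_pos_of_mem_QSetOf hΩ).ne'
  by_cases hαΩ : α ∈ Ω <;> simp [hαΩ, h1, h2]

theorem dact_image_eq (h : IsExtendedBase R Δ αt n ϖ) {z : V ≃ₗ[ℚ] V}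
    (hz : z ∈ AutTildeL R Δ αt L) {v : V}
    (hv : (fun x => z x + v) '' alcove Δ αt = alcove Δ αt) {x y : V} (hxy : z x + v = y) :
    dact z '' {α | α ∈ extFin Δ αt ∧ wallHeight αt α x ≠ 0}
      = {α | α ∈ extFin Δ αt ∧ wallHeight αt α y ≠ 0} := by
  ext β
  constructor
  · rintro ⟨α, ⟨hα, hne⟩, rfl⟩
    refine ⟨dact_mem_of_mem_AutTildeL hz hα, ?_⟩
    rwa [← hxy, h.wallHeight_dact hz hv hα]
  · rintro ⟨hβ, hne⟩
    have hβ' := mem_extBase_iff.2 hβ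
    rw [← hz.1.2] at hβ'
    obtain ⟨α, hα, rfl⟩ := hβ'
    rw [mem_extBase_iff] at hα
    rw [← hxy, h.wallHeight_dact hz hv hα] at hne
    exact ⟨α, ⟨hα, hne⟩, rfl⟩

theorem eq_setOf_wallHeight_lamOf (h : IsExtendedBase R Δ αt n ϖ)
    {Ω : Set (Module.Dual ℚ V)} (hΩ : Ω ∈ QSetOf R Δ αt L) :
    {α | α ∈ extFin Δ αt ∧ wallHeight αt α (lamOf n ϖ Ω) ≠ 0} = Ω := by
  ext α
  constructor
  · rintro ⟨hα, hne⟩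
    exact (h.mem_iff_wallHeight_lamOf hΩ hα).2 hne
  · intro hα
    have hα' := mem_extBase_iff.1 (hΩ.1 hα)
    exact ⟨hα', (h.mem_iff_wallHeight_lamOf hΩ hα').1 hα⟩

theorem apply_lamOf (h : IsExtendedBase R Δ αt n ϖ) {Ω Ω' : Set (Module.Dual ℚ V)}
    (hΩ : Ω ∈ QSetOf R Δ αt L) (hΩ' : Ω' ∈ QSetOf R Δ αt L) {z : V ≃ₗ[ℚ] V}
    (hz : z ∈ AutTildeL R Δ αt L) {v : V}
    (hv : (fun x => z x + v) '' alcove Δ αt = alcove Δ αt) (hzΩ : dact z '' Ω = Ω') :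
    z (lamOf n ϖ Ω) + v = lamOf n ϖ Ω' := by
  classical
  refine h.eq_of_wallHeight_eq fun β hβ => ?_
  have hβ' := mem_extBase_iff.2 hβ
  rw [← hz.1.2] at hβ'
  obtain ⟨α, hα, rfl⟩ := hβ'
  rw [mem_extBase_iff] at hα
  rw [h.wallHeight_dact hz hv hα, h.wallHeight_lamOf hΩ hα, h.wallHeight_lamOf hΩ' hβ,
    h.n_dact hz hα, ← hzΩ, Set.ncard_image_of_injective _ (dact_injective z),
    (dact_injective z).mem_set_image]

theorem isQuasiIsolated_lamOf (h : IsExtendedBase R Δ αt n ϖ)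
    (hQL : (corootLattice R : Set V) ⊆ L) {Ω : Set (Module.Dual ℚ V)}
    (hΩ : Ω ∈ QSetOf R Δ αt L) : IsQuasiIsolated R L (lamOf n ϖ Ω) := by
  classical
  rw [IsQuasiIsolated, eq_bot_iff]
  intro u hu
  have hout : ∀ α ∈ extFin Δ αt, α ∉ Ω → α u = 0 := by
    intro α hα hαΩ
    have hαΦ := h.mem_root hα
    have h0 := h.wallHeight_lamOf hΩ hα
    rw [if_neg hαΩ, wallHeight, sub_eq_zero] at h0
    obtain ⟨k, hk⟩ := exists_int_eq_mfun αt α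
    have hs : R.refl hαΦ ∈ weylOf R {α} := R.refl_mem_weylOf hαΦ rfl
    have hsub : ({α} : Set (Module.Dual ℚ V)) ⊆ R.Φ := Set.singleton_subset_iff.2 hαΦ
    have hfix := hu (R.refl hαΦ) ⟨R.weylOf_le hsub hs,
      hQL (R.sub_mem_corootLattice hsub hs _ (by
        rintro _ rfl
        exact ⟨k, by rw [hk, h0]⟩)).1⟩
    rw [R.refl_apply, sub_eq_self] at hfix
    have := congrArg α hfix
    rw [map_smul, R.pairing_self α hαΦ, map_zero, smul_eq_mul] at this
    linarith
  have hconst : ∀ α ∈ Ω, ∀ β ∈ Ω, α u = β u := by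
    intro α hα β hβ
    obtain ⟨z, hz, hzΩ, rfl⟩ := hΩ.2.2 α hα β hβ
    obtain ⟨-, v, hvL, hv⟩ := id hz
    have hlam := h.apply_lamOf hΩ hΩ hz hv hzΩ
    have hfix := hu z ⟨hz.1.1, by
      rw [show z (lamOf n ϖ Ω) - lamOf n ϖ Ω = -v by
        rw [sub_eq_iff_eq_add, ← sub_eq_neg_add, eq_sub_iff_add_eq, hlam]]
      exact neg_mem hvL⟩
    conv_rhs => rw [← hfix]
    rw [dact_apply_apply]
  obtain ⟨α₁, hα₁⟩ := hΩ.2.1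
  have hα₁' := mem_extBase_iff.1 (hΩ.1 hα₁)
  have hzero : α₁ u = 0 := by
    have hs := h.sum_mul_apply u
    rw [Finset.sum_congr rfl (g := fun α => (if α ∈ Ω then (n α : ℚ) else 0) * α₁ u),
      ← Finset.sum_mul] at hs
    · refine (mul_eq_zero.1 hs).resolve_left (ne_of_gt ?_)
      refine Finset.sum_pos' (fun α hα => ?_) ⟨α₁, hα₁', ?_⟩
      · split_ifs <;> positivity
      · rw [if_pos hα₁]
        exact h.n_pos hα₁'
    · intro α hα
      by_cases hαΩ : α ∈ Ω
      · rw [if_pos hαΩ, hconst α hαΩ α₁ hα₁]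
      · rw [if_neg hαΩ, hout α hα hαΩ, mul_zero, zero_mul]
  rw [Submodule.mem_bot]
  refine h.eq_of_forall_apply_eq fun α hα => ?_
  rw [map_zero]
  by_cases hαΩ : α ∈ Ω
  · rw [hconst α hαΩ α₁ hα₁, hzero]
  · exact hout α (mem_extFin.2 (Or.inr hα)) hαΩ

theorem image_mul_add_eq {z₁ z₂ : V ≃ₗ[ℚ] V} {v₁ v₂ : V} {C : Set V}
    (h₁ : (fun x => z₁ x + v₁) '' C = C) (h₂ : (fun x => z₂ x + v₂) '' C = C) :
    (fun x => (z₁ * z₂) x + (z₁ v₂ + v₁)) '' C = C := by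
  conv_rhs => rw [← h₁, ← h₂, Set.image_image]
  refine Set.image_congr fun x _ => ?_
  rw [LinearEquiv.mul_apply, map_add, add_assoc]

theorem one_mem_AutTildeL : (1 : V ≃ₗ[ℚ] V) ∈ AutTildeL R Δ αt L :=
  ⟨⟨one_mem _, Set.image_id _⟩, 0, zero_mem _, by simp⟩

theorem mul_mem_AutTildeL (hQL : (corootLattice R : Set V) ⊆ L)
    (hLP : (L : Set V) ⊆ coweightSet R) {z₁ z₂ : V ≃ₗ[ℚ] V}
    (h₁ : z₁ ∈ AutTildeL R Δ αt L) (h₂ : z₂ ∈ AutTildeL R Δ αt L) :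
    z₁ * z₂ ∈ AutTildeL R Δ αt L := by
  obtain ⟨⟨hw₁, hd₁⟩, v₁, hv₁, hC₁⟩ := h₁
  obtain ⟨⟨hw₂, hd₂⟩, v₂, hv₂, hC₂⟩ := h₂
  refine ⟨⟨mul_mem hw₁ hw₂, ?_⟩, z₁ v₂ + v₁,
    add_mem (R.apply_mem_of_weyl hQL hLP hw₁ hv₂) hv₁, image_mul_add_eq hC₁ hC₂⟩
  change (dact z₁ ∘ dact z₂) '' _ = _
  rw [Set.image_comp, hd₂, hd₁]

theorem apply_eq_of_mem_weylOf {S : Set (Module.Dual ℚ V)} {u : V} (hu : ∀ α ∈ S, α u = 0)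
    {w : V ≃ₗ[ℚ] V} (hw : w ∈ weylOf R S) : w u = u := by
  have : weylOf R S ≤ MulAction.stabilizer (V ≃ₗ[ℚ] V) u := by
    refine (Subgroup.closure_le _).2 ?_
    rintro w ⟨α, hα, h⟩
    change w u = u
    rw [h, hu α hα, zero_smul, sub_zero]
  exact this hw

/-- The stabilizer in `𝒜_L` of a quasi-isolated point of the alcove acts transitively on the
set of walls not containing this point. -/
theorem exists_dact_eq_of_isQuasiIsolated (h : IsExtendedBase R Δ αt n ϖ)
    (hQL : (corootLattice R : Set V) ⊆ L) (hLP : (L : Set V) ⊆ coweightSet R) {y : V}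
    (hy : y ∈ alcove Δ αt) (hq : IsQuasiIsolated R L y) {α β : Module.Dual ℚ V}
    (hα : α ∈ extFin Δ αt) (hα0 : wallHeight αt α y ≠ 0)
    (hβ : β ∈ extFin Δ αt) (hβ0 : wallHeight αt β y ≠ 0) :
    ∃ z ∈ AutTildeL R Δ αt L, (∃ v, (fun x => z x + v) '' alcove Δ αt = alcove Δ αt ∧
      z y + v = y) ∧ dact z α = β := by
  classical
  by_contra! hcon
  set T : Finset (Module.Dual ℚ V) := {γ ∈ extFin Δ αt | wallHeight αt γ y ≠ 0} with hT
  set O : Finset (Module.Dual ℚ V) := {γ ∈ T | ∃ z ∈ AutTildeL R Δ αt L,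
    (∃ v, (fun x => z x + v) '' alcove Δ αt = alcove Δ αt ∧ z y + v = y) ∧ dact z α = γ}
    with hO
  have hOT : O ⊆ T := Finset.filter_subset _ _
  have hTE : T ⊆ extFin Δ αt := Finset.filter_subset _ _
  have hαT : α ∈ T := Finset.mem_filter.2 ⟨hα, hα0⟩
  have hαO : α ∈ O :=
    Finset.mem_filter.2 ⟨hαT, 1, one_mem_AutTildeL, ⟨0, by simp, by simp⟩, rfl⟩
  have hβO : β ∈ T \ O := by
    refine Finset.mem_sdiff.2 ⟨Finset.mem_filter.2 ⟨hβ, hβ0⟩, fun hmem => ?_⟩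
    obtain ⟨-, z, hz, hzv, hzα⟩ := Finset.mem_filter.1 hmem
    exact hcon z hz hzv hzα
  set a : ℚ := ∑ γ ∈ O, (n γ : ℚ) with ha
  set b : ℚ := ∑ γ ∈ T \ O, (n γ : ℚ) with hb
  have hbpos : 0 < b := Finset.sum_pos
    (fun γ hγ => h.n_pos (hTE (Finset.sdiff_subset hγ))) ⟨β, hβO⟩
  set f : Module.Dual ℚ V → ℚ := fun γ => if γ ∈ O then b else if γ ∈ T then -a else 0 with hf
  have hfsum : ∑ γ ∈ extFin Δ αt, (n γ : ℚ) * f γ = 0 := by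
    rw [← Finset.sum_subset hTE fun γ _ hγ => by
      rw [hf]
      simp only
      rw [if_neg fun hγO => hγ (hOT hγO), if_neg hγ, mul_zero],
      ← Finset.sum_sdiff hOT,
      Finset.sum_congr rfl (g := fun γ => (n γ : ℚ) * (-a)) fun γ hγ => by
        obtain ⟨hγT, hγO⟩ := Finset.mem_sdiff.1 hγ
        simp only [hf, if_neg hγO, if_pos hγT],
      Finset.sum_congr (s₁ := O) rfl (g := fun γ => (n γ : ℚ) * b) fun γ hγ => by
        simp only [hf, if_pos hγ],
      ← Finset.sum_mul, ← Finset.sum_mul]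
    ring
  set u : V := ∑ γ ∈ extFin Δ αt, f γ • ϖ γ with hu
  have hfu : ∀ γ ∈ extFin Δ αt, γ u = f γ := fun γ hγ =>
    h.apply_sum_smul_of_sum_eq_zero hfsum hγ
  have hinvar : ∀ z ∈ AutTildeL R Δ αt L, ∀ v,
      (fun x => z x + v) '' alcove Δ αt = alcove Δ αt → z y + v = y →
      ∀ γ ∈ extFin Δ αt, f (dact z γ) = f γ := by
    intro z hz v hv hzy γ hγ
    have hTiff : ∀ δ ∈ extFin Δ αt, dact z δ ∈ T ↔ δ ∈ T := by
      intro δ hδ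
      have := h.wallHeight_dact hz hv hδ y
      rw [hzy] at this
      simp [hT, hδ, dact_mem_of_mem_AutTildeL hz hδ, this]
    have hmap : ∀ δ ∈ O, dact z δ ∈ O := by
      intro δ hδ
      obtain ⟨hδT, z', hz', ⟨v', hv', hz'y⟩, hz'α⟩ := Finset.mem_filter.1 hδ
      refine Finset.mem_filter.2 ⟨(hTiff δ (hTE hδT)).2 hδT, z * z',
        mul_mem_AutTildeL hQL hLP hz hz', ⟨_, image_mul_add_eq hv hv', ?_⟩, ?_⟩
      · rw [LinearEquiv.mul_apply, ← add_assoc, ← map_add, hz'y, hzy]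
      · rw [← hz'α]
        rfl
    have himage : O.image (dact z) = O :=
      Finset.eq_of_subset_of_card_le (Finset.image_subset_iff.2 hmap)
        (Finset.card_image_of_injective _ (dact_injective z)).ge
    have hOiff : dact z γ ∈ O ↔ γ ∈ O := by
      conv_lhs => rw [← himage]
      exact (dact_injective z).mem_finset_image
    simp only [hf, hOiff, hTiff γ hγ]
  have hufix : u ∈ fixedSub {w : V ≃ₗ[ℚ] V | w ∈ weyl R ∧ w y - y ∈ L} := by
    rintro w ⟨hw, hwy⟩
    have hwl : w y + (y - w y) = y := add_sub_cancel _ _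
    obtain ⟨w', hw', z, hz, rfl, v, hv, hzy⟩ := h.exists_decomposition hQL hLP hw
      (l := y - w y) (by simpa using neg_mem hwy) hy (by rwa [hwl])
    rw [hwl] at hzy
    rw [LinearEquiv.mul_apply, apply_eq_of_mem_weylOf (fun γ hγ => ?_) hw']
    · refine h.eq_of_forall_apply_eq fun γ hγ => ?_
      have hγ' : γ ∈ extBase Δ αt := mem_extBase_iff.2 (mem_extFin.2 (Or.inr hγ))
      rw [← hz.1.2] at hγ'
      obtain ⟨δ, hδ, rfl⟩ := hγ'
      rw [mem_extBase_iff] at hδ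
      rw [dact_apply_apply, hfu _ hδ, hfu _ (mem_extFin.2 (Or.inr hγ)),
        hinvar z hz v hv hzy δ hδ]
    · obtain ⟨hγE, hγ0⟩ := mem_IOf_iff.1 hγ
      have hγT : γ ∉ T := fun hmem => (Finset.mem_filter.1 hmem).2 hγ0
      rw [hfu γ hγE, hf]
      simp only
      rw [if_neg fun hγO => hγT (hOT hγO), if_neg hγT]
  rw [IsQuasiIsolated] at hq
  rw [hq, Submodule.mem_bot] at hufix
  have := hfu α hα
  rw [hufix, map_zero] at this
  simp only [hf, if_pos hαO] at this
  exact hbpos.ne this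

theorem exists_eq_lamOf (h : IsExtendedBase R Δ αt n ϖ)
    (hQL : (corootLattice R : Set V) ⊆ L) (hLP : (L : Set V) ⊆ coweightSet R) {y : V}
    (hy : y ∈ alcove Δ αt) (hq : IsQuasiIsolated R L y) :
    ∃ Ω ∈ QSetOf R Δ αt L, lamOf n ϖ Ω = y := by
  classical
  set T : Finset (Module.Dual ℚ V) := {γ ∈ extFin Δ αt | wallHeight αt γ y ≠ 0} with hT
  have hTmem : ∀ γ, γ ∈ T ↔ γ ∈ extFin Δ αt ∧ wallHeight αt γ y ≠ 0 := fun γ => by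
    simp [hT]
  have hTset : (T : Set (Module.Dual ℚ V))
      = {γ | γ ∈ extFin Δ αt ∧ wallHeight αt γ y ≠ 0} := by
    ext γ
    exact hTmem γ
  have hsum := h.sum_mul_wallHeight y
  rw [← Finset.sum_subset (Finset.filter_subset (wallHeight αt · y ≠ 0) _) (by
    intro γ hγ hγ'
    have : wallHeight αt γ y = 0 := by
      by_contra hne
      exact hγ' (Finset.mem_filter.2 ⟨hγ, hne⟩)
    rw [this, mul_zero]), ← hT] at hsum
  have htrans := fun {α β} (hα : α ∈ T) (hβ : β ∈ T) =>
    h.exists_dact_eq_of_isQuasiIsolated hQL hLP hy hq ((hTmem α).1 hα).1 ((hTmem α).1 hα).2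
      ((hTmem β).1 hβ).1 ((hTmem β).1 hβ).2
  have hΩ : (T : Set (Module.Dual ℚ V)) ∈ QSetOf R Δ αt L := by
    refine ⟨fun γ hγ => mem_extBase_iff.2 ((hTmem γ).1 hγ).1, ?_, fun α hα β hβ => ?_⟩
    · rw [Finset.coe_nonempty, Finset.nonempty_iff_ne_empty]
      intro hempty
      rw [hempty, Finset.sum_empty] at hsum
      exact zero_ne_one hsum
    · obtain ⟨z, hz, ⟨v, hv, hzy⟩, hzα⟩ := htrans hα hβ
      refine ⟨z, hz, ?_, hzα⟩
      rw [hTset]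
      exact h.dact_image_eq hz hv hzy
  refine ⟨T, hΩ, h.eq_of_wallHeight_eq fun α hα => ?_⟩
  rw [h.wallHeight_lamOf hΩ hα, Set.ncard_coe_finset]
  by_cases hαT : α ∈ T
  · rw [if_pos (Finset.mem_coe.2 hαT)]
    rw [Finset.sum_congr rfl (g := fun _ => (n α : ℚ) * wallHeight αt α y) (by
      intro β hβ
      obtain ⟨z, hz, ⟨v, hv, hzy⟩, rfl⟩ := htrans hαT hβ
      have := h.wallHeight_dact hz hv hα y
      rw [hzy] at this
      rw [this, h.n_dact hz hα]), Finset.sum_const, nsmul_eq_mul] at hsum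
    refine inv_eq_of_mul_eq_one_right ?_
    rw [← hsum]
    ring
  · rw [if_neg fun hmem => hαT (Finset.mem_coe.1 hmem)]
    by_contra hne
    exact hαT ((hTmem α).2 ⟨hα, Ne.symm hne⟩)

end IsExtendedBase

/-- The map Ω ↦ λ_Ω induces a bijection between the orbits of 𝒜_L on
𝒬_L and the orbits under W ⋉ L of the quasi-isolated elements of V: n is constant on
each Ω ∈ 𝒬_L, each λ_Ω is quasi-isolated, two Ω's are 𝒜_L-conjugate iff the λ_Ω's are
(W ⋉ L)-conjugate, and every quasi-isolated element is (W ⋉ L)-conjugate to some λ_Ω. -/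
theorem classification_of_quasiIsolated
    {V : Type*} [AddCommGroup V] [Module ℚ V] [FiniteDimensional ℚ V]
    (R : RootSystemData V)
    (Δ : Finset (Module.Dual ℚ V))
    (hΔΦ : (Δ : Set (Module.Dual ℚ V)) ⊆ R.Φ)
    (hΔind : LinearIndependent ℚ
      (fun x : (Δ : Set (Module.Dual ℚ V)) => (x : Module.Dual ℚ V)))
    (hΔbase : ∀ α ∈ R.Φ, ∃ c : Module.Dual ℚ V →₀ ℤ,
        (c.support : Set (Module.Dual ℚ V)) ⊆ (Δ : Set (Module.Dual ℚ V)) ∧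
        α = c.sum (fun β k => (k : ℚ) • β) ∧
        ((∀ β, 0 ≤ c β) ∨ (∀ β, c β ≤ 0)))
    (αt : Module.Dual ℚ V) (hαtΦ : αt ∈ R.Φ)
    (hhigh : ∀ γ ∈ R.Φ, ∃ c : Module.Dual ℚ V →₀ ℚ,
        (c.support : Set (Module.Dual ℚ V)) ⊆ (Δ : Set (Module.Dual ℚ V)) ∧
        αt - γ = c.sum (fun β k => k • β) ∧ (∀ β, 0 ≤ c β))
    (hα₀ : -αt ∉ (Δ : Set (Module.Dual ℚ V)))
    (L : AddSubgroup V)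
    (hQL : (corootLattice R : Set V) ⊆ (L : Set V))
    (hLP : (L : Set V) ⊆ coweightSet R)
    (n : Module.Dual ℚ V → ℕ)
    (hnsum : αt = ∑ β ∈ Δ, (n β : ℚ) • β)
    (hnpos : ∀ β ∈ Δ, 0 < n β)
    (hn0 : n (-αt) = 1)
    (ϖ : Module.Dual ℚ V → V)
    (hϖ : ∀ β ∈ Δ, β (ϖ β) = 1 ∧ ∀ γ ∈ Δ, γ ≠ β → γ (ϖ β) = 0)
    (hϖ0 : ϖ (-αt) = 0)
    :
    (∀ Ω ∈ QSetOf R Δ αt L, ∀ α ∈ Ω, ∀ β ∈ Ω, n α = n β) ∧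
    (∀ Ω ∈ QSetOf R Δ αt L, IsQuasiIsolated R L (lamOf n ϖ Ω)) ∧
    (∀ Ω ∈ QSetOf R Δ αt L, ∀ Ω' ∈ QSetOf R Δ αt L,
      ((∃ z ∈ AutTildeL R Δ αt L, dact z '' Ω = Ω') ↔
        (∃ w ∈ weyl R, ∃ l ∈ L, w (lamOf n ϖ Ω) + l = lamOf n ϖ Ω'))) ∧
    (∀ x : V, IsQuasiIsolated R L x →
      ∃ Ω ∈ QSetOf R Δ αt L, ∃ w ∈ weyl R, ∃ l ∈ L, w (lamOf n ϖ Ω) + l = x) := by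
  have h : IsExtendedBase R Δ αt n ϖ :=
    { subset := hΔΦ
      nonneg_or_nonpos := by
        intro β hβ
        obtain ⟨c, hc, hβc, hsign⟩ := hΔbase β hβ
        have hsum : β = ∑ α ∈ Δ, (c α : ℚ) • α := by
          rw [hβc]
          exact Finsupp.sum_of_support_subset c (by exact_mod_cast hc) _ (by simp)
        rcases hsign with hsign | hsign
        · exact ⟨fun α => c α, fun α _ => Int.cast_nonneg (hsign α), Or.inl hsum⟩
        · refine ⟨fun α => -c α, fun α _ => ?_, Or.inr ?_⟩
          · exact neg_nonneg.2 (Int.cast_nonpos.2 (hsign α))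
          · conv_lhs => rw [hsum]
            simp [neg_smul, Finset.sum_neg_distrib]
      highest_mem := hαtΦ
      highest := by
        intro γ hγ
        obtain ⟨c, hc, hγc, hsign⟩ := hhigh γ hγ
        refine ⟨c, fun α _ => hsign α, ?_⟩
        rw [hγc]
        exact Finsupp.sum_of_support_subset c (by exact_mod_cast hc) _ (by simp)
      neg_highest_notMem := hα₀
      sum_eq := hnsum
      pos := hnpos
      one := hn0
      dual_self := fun β hβ => (hϖ β hβ).1
      dual_ne := fun β hβ => (hϖ β hβ).2
      dual_neg_highest := hϖ0 }
  refine ⟨fun Ω hΩ α hα β hβ => h.n_eq_of_mem_QSetOf hΩ hα hβ,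
    fun Ω hΩ => h.isQuasiIsolated_lamOf hQL hΩ, fun Ω hΩ Ω' hΩ' => ⟨?_, ?_⟩, fun x hx => ?_⟩
  · rintro ⟨z, hz, hzΩ⟩
    obtain ⟨⟨hw, -⟩, v, hvL, hv⟩ := id hz
    exact ⟨z, hw, v, hvL, h.apply_lamOf hΩ hΩ' hz hv hzΩ⟩
  · rintro ⟨w, hw, l, hl, hwl⟩
    obtain ⟨w', -, z, hz, -, v, hv, hzv⟩ := h.exists_decomposition hQL hLP hw hl
      (h.lamOf_mem_alcove hΩ) (hwl ▸ h.lamOf_mem_alcove hΩ')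
    refine ⟨z, hz, ?_⟩
    have := h.dact_image_eq hz hv (hzv.trans hwl)
    rwa [h.eq_setOf_wallHeight_lamOf hΩ, h.eq_setOf_wallHeight_lamOf hΩ'] at this
  · obtain ⟨w, hw, l, hl, hy⟩ := h.exists_mem_alcove hQL hLP x
    obtain ⟨Ω, hΩ, hlam⟩ := h.exists_eq_lamOf hQL hLP hy (hx.conj hQL hLP hw hl)
    refine ⟨Ω, hΩ, w⁻¹, inv_mem hw, -(w⁻¹ l),
      neg_mem (R.apply_mem_of_weyl hQL hLP (inv_mem hw) hl), ?_⟩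
    rw [hlam, map_add, add_neg_cancel_right]
    exact w.symm_apply_apply x
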